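/- arXiv:2411.15485 — 2 statements merged into one kernel-verified Lean document; each statement's English description precedes it below -/
import Mathlib

section
/- For every λ ≥ 0, Φ^{(n)}(λ) → Φ(λ) as n → ∞, where Φ^{(n)}(λ) := n·(1 − γ_n·‖Π̄_n‖_{L¹})·λ + n²·γ_n·∫₀^∞ (e^{−λy/n} − 1 + λy/n) π_n(y) dy. -/
open MeasureTheory Real Set Filter Topology

noncomputable def tailNu (ν : Measure ℝ) (y : ℝ) : ℝ := (ν (Set.Ici y)).toReal

noncomputable def itailNu (ν : Measure ℝ) (x : ℝ) : ℝ := ∫ y in Set.Ioi x, tailNu ν y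

noncomputable def phi (b c : ℝ) (ν : Measure ℝ) (l : ℝ) : ℝ :=
  b * l + c * l ^ 2 + ∫ y in Set.Ioi (0 : ℝ), (Real.exp (-l * y) - 1 + l * y) ∂ν

noncomputable def expDens (c y : ℝ) : ℝ := (1 / c) * Real.exp (-y / c)

noncomputable def gam (b c : ℝ) (ν : Measure ℝ) (η : ℕ → ℝ) (n : ℕ) : ℝ :=
  (1 / c) * max 0 (1 - b / (n : ℝ) - (1 / (n : ℝ)) * ∫ y in Set.Ioi (0 : ℝ), tailNu ν (η n + y))

noncomputable def piDens (c θn : ℝ) (Λn : Measure ℝ) (y : ℝ) : ℝ :=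
  (1 - θn) * expDens c y + θn * ∫ u in Set.Icc (0 : ℝ) y, expDens c (y - u) ∂Λn

noncomputable def piTail (c θn : ℝ) (Λn : Measure ℝ) (x : ℝ) : ℝ :=
  ∫ y in Set.Ioi x, piDens c θn Λn y

noncomputable def piTailL1 (c θn : ℝ) (Λn : Measure ℝ) : ℝ :=
  ∫ y in Set.Ioi (0 : ℝ), piTail c θn Λn y

noncomputable def phiN (b c : ℝ) (ν : Measure ℝ) (η θ : ℕ → ℝ) (Λ : ℕ → Measure ℝ)
    (n : ℕ) (l : ℝ) : ℝ :=
  (n : ℝ) * (1 - gam b c ν η n * piTailL1 c (θ n) (Λ n)) * l +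
    (n : ℝ) ^ 2 * gam b c ν η n *
      ∫ y in Set.Ioi (0 : ℝ),
        (Real.exp (-l * y / (n : ℝ)) - 1 + l * y / (n : ℝ)) * piDens c (θ n) (Λ n) y

noncomputable def eC (c : ℝ) : ℝ → ℝ := (Set.Ici (0:ℝ)).indicator (expDens c)

lemma eC_meas (c : ℝ) : Measurable (eC c) := by
  unfold eC
  refine Measurable.indicator ?_ measurableSet_Ici
  unfold expDens
  fun_prop

lemma eC_exp_integrable {c : ℝ} (hc : 0 < c) {s : ℝ} (hs : 0 ≤ s) :
    Integrable (fun x => Real.exp (-s * x) * eC c x) ∧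
      ∫ x, Real.exp (-s * x) * eC c x = 1 / (1 + s * c) := by
  have h : (fun x => Real.exp (-s * x) * eC c x)
      = (Set.Ici (0:ℝ)).indicator (fun x => (1/c) * Real.exp (-(s + 1/c) * x)) := by
    funext x
    by_cases hx : x ∈ Set.Ici (0:ℝ)
    · simp only [eC, Set.indicator_of_mem hx, expDens]
      rw [mul_left_comm, ← Real.exp_add]
      congr 2
      ring
    · simp [eC, Set.indicator_of_notMem hx]
  have hp : 0 < s + 1/c := by positivity
  rw [h]
  constructor
  · rw [integrable_indicator_iff measurableSet_Ici, integrableOn_Ici_iff_integrableOn_Ioi]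
    exact (exp_neg_integrableOn_Ioi 0 hp).const_mul _
  · rw [integral_indicator measurableSet_Ici, integral_Ici_eq_integral_Ioi,
      integral_const_mul, integral_exp_mul_Ioi (by linarith)]
    simp only [mul_zero, Real.exp_zero]
    rw [neg_div_neg_eq]
    field_simp
    ring

lemma eC_id_integrable {c : ℝ} (hc : 0 < c) :
    Integrable (fun x => x * eC c x) ∧ ∫ x, x * eC c x = c := by
  have h : (fun x => x * eC c x)
      = (Set.Ici (0:ℝ)).indicator (fun x => (1/c) * (x * Real.exp (-(1/c * x)))) := by
    funext x
    by_cases hx : x ∈ Set.Ici (0:ℝ)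
    · simp only [eC, Set.indicator_of_mem hx, expDens]
      rw [mul_left_comm]
      congr 3
      ring
    · simp [eC, Set.indicator_of_notMem hx]
  have hp : 0 < 1/c := by positivity
  rw [h]
  constructor
  · rw [integrable_indicator_iff measurableSet_Ici, integrableOn_Ici_iff_integrableOn_Ioi]
    have := integrableOn_rpow_mul_exp_neg_mul_rpow (p := 1) (s := 1) (b := 1/c) (by norm_num) (by norm_num) hp
    simp only [Real.rpow_one] at this
    refine Integrable.const_mul ?_ _
    simp only [neg_mul] at this
    exact this
  · rw [integral_indicator measurableSet_Ici, integral_Ici_eq_integral_Ioi,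
      integral_const_mul]
    have := integral_rpow_mul_exp_neg_mul_Ioi (a := 2) (r := 1/c) (by norm_num) hp
    norm_num at this
    simp only [one_div]
    rw [this]
    field_simp

lemma eC_one_integrable {c : ℝ} (hc : 0 < c) :
    Integrable (eC c) ∧ ∫ x, eC c x = 1 := by
  have := eC_exp_integrable hc (le_refl (0:ℝ))
  simpa using this

lemma piDens_eq {c θ : ℝ} {P : Measure ℝ} (hP0 : P (Set.Iic 0) = 0) {y : ℝ} (hy : 0 < y) :
    piDens c θ P y = (1 - θ) * eC c y + θ * ∫ u, eC c (y - u) ∂P := by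
  unfold piDens
  have h1 : eC c y = expDens c y := by
    simp [eC, Set.indicator_of_mem, hy.le]
  rw [h1, ← integral_indicator measurableSet_Icc]
  congr 2
  have h0 : ∀ᵐ u ∂P, 0 < u := by
    rw [ae_iff]; convert hP0 using 2; ext; simp
  refine integral_congr_ae ?_
  filter_upwards [h0] with u hu
  by_cases h : u ≤ y
  · simp [eC, Set.indicator, h, hu.le]
  · simp [eC, Set.indicator, h]

lemma piDens_int {c θ : ℝ} {P : Measure ℝ} [IsProbabilityMeasure P]
    (hP0 : P (Set.Iic 0) = 0) {f : ℝ → ℝ} (hf : Measurable f)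
    (h1 : Integrable (fun x => f x * eC c x))
    (h2 : Integrable (fun z : ℝ × ℝ => f (z.1 + z.2) * eC c z.2) (P.prod volume)) :
    IntegrableOn (fun y => f y * piDens c θ P y) (Set.Ioi 0) ∧
    ∫ y in Set.Ioi (0:ℝ), f y * piDens c θ P y =
      (1 - θ) * (∫ x, f x * eC c x) +
        θ * ∫ z : ℝ × ℝ, f (z.1 + z.2) * eC c z.2 ∂(P.prod volume) := by
  have h0 : ∀ᵐ u ∂P, 0 < u := by
    rw [ae_iff]; convert hP0 using 2; ext; simp
  have hmp := measurePreserving_prod_add P (volume : Measure ℝ)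
  set F : ℝ × ℝ → ℝ := fun z => f z.2 * eC c (z.2 - z.1) with hF
  have hFm : Measurable F := by
    have := eC_meas c
    simp only [hF]; fun_prop
  have hcomp : (fun z : ℝ × ℝ => f (z.1 + z.2) * eC c z.2) = F ∘ (fun z : ℝ × ℝ => (z.1, z.1 + z.2)) := by
    funext z; simp [hF]
  have hFi : Integrable F (P.prod volume) := by
    rw [hcomp] at h2
    exact (hmp.integrable_comp hFm.aestronglyMeasurable).1 h2
  have hint : ∫ z : ℝ × ℝ, f (z.1 + z.2) * eC c z.2 ∂(P.prod volume) = ∫ z, F z ∂(P.prod volume) := by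
    rw [hcomp]
    conv_rhs => rw [← hmp.map_eq]
    rw [integral_map hmp.aemeasurable hFm.aestronglyMeasurable]
    rfl
  have hFr := hFi.integral_prod_right
  rw [hint, integral_prod_symm _ hFi]
  have e1 : ∫ x, f x * eC c x = ∫ x in Set.Ioi (0:ℝ), f x * eC c x := by
    rw [← integral_Ici_eq_integral_Ioi, ← integral_indicator measurableSet_Ici]
    congr 1; funext x
    by_cases hx : x ∈ Set.Ici (0:ℝ)
    · simp [Set.indicator_of_mem hx]
    · simp [Set.indicator_of_notMem hx, eC]
  have e2 : ∫ y, ∫ x, F (x, y) ∂P = ∫ y in Set.Ioi (0:ℝ), ∫ x, F (x, y) ∂P := by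
    rw [← integral_Ici_eq_integral_Ioi, ← integral_indicator measurableSet_Ici]
    congr 1; funext x
    by_cases hx : x ∈ Set.Ici (0:ℝ)
    · simp [Set.indicator_of_mem hx]
    · simp only [Set.indicator_of_notMem hx]
      refine integral_eq_zero_of_ae ?_
      filter_upwards [h0] with u hu
      have : ¬ (u ≤ x) := by simp at hx; linarith
      simp [hF, eC, Set.indicator, this]
  have e3 : ∀ y ∈ Set.Ioi (0:ℝ), f y * piDens c θ P y =
      (1 - θ) * (f y * eC c y) + θ * ∫ x, F (x, y) ∂P := by
    intro y hy
    rw [piDens_eq hP0 hy]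
    simp only [hF]
    rw [integral_const_mul]
    ring
  have i1 := (h1.integrableOn (s := Set.Ioi (0:ℝ))).const_mul (1 - θ)
  have i2 := (hFr.integrableOn (s := Set.Ioi (0:ℝ))).const_mul θ
  constructor
  · exact (integrableOn_congr_fun e3 measurableSet_Ioi).2 (i1.add i2)
  · rw [setIntegral_congr_fun measurableSet_Ioi e3, integral_add i1 i2, integral_const_mul,
      integral_const_mul, e1, e2]

lemma piDens_one {c θ : ℝ} (hc : 0 < c) {P : Measure ℝ} [IsProbabilityMeasure P]
    (hP0 : P (Set.Iic 0) = 0) : IntegrableOn (piDens c θ P) (Set.Ioi 0) := by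
  have := (piDens_int (c := c) (θ := θ) hP0 (f := fun _ => 1) measurable_const
    (by simpa using (eC_one_integrable hc).1)
    ((integrable_const (1:ℝ)).mul_prod (eC_one_integrable hc).1)).1
  simpa using this

lemma piDens_id {c θ : ℝ} (hc : 0 < c) {P : Measure ℝ} [IsProbabilityMeasure P]
    (hP0 : P (Set.Iic 0) = 0) (hPi : Integrable (fun u => u) P) :
    IntegrableOn (fun y => y * piDens c θ P y) (Set.Ioi 0) ∧
    ∫ y in Set.Ioi (0:ℝ), y * piDens c θ P y = c + θ * ∫ u, u ∂P := by
  have a1 := hPi.mul_prod (eC_one_integrable hc).1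
  have a2 := (integrable_const (μ := P) (1:ℝ)).mul_prod (eC_id_integrable hc).1
  have hh : (fun z : ℝ × ℝ => (z.1 + z.2) * eC c z.2)
      = fun z => z.1 * eC c z.2 + 1 * (z.2 * eC c z.2) := by funext z; ring
  have := piDens_int (c := c) (θ := θ) hP0 (f := fun x => x) measurable_id
    (eC_id_integrable hc).1 (by rw [hh]; exact a1.add a2)
  refine ⟨this.1, ?_⟩
  rw [this.2, hh, integral_add a1 a2, integral_prod_mul (fun x : ℝ => x) (eC c),
    integral_prod_mul (fun x : ℝ => (1:ℝ)) (fun x => x * eC c x), (eC_id_integrable hc).2,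
    (eC_one_integrable hc).2]
  simp
  ring

lemma piDens_g {c θ s : ℝ} (hc : 0 < c) (hs : 0 ≤ s) {P : Measure ℝ} [IsProbabilityMeasure P]
    (hP0 : P (Set.Iic 0) = 0) (hPi : Integrable (fun u => u) P)
    (hPe : Integrable (fun u => Real.exp (-s * u)) P) :
    ∫ y in Set.Ioi (0:ℝ), (Real.exp (-s * y) - 1 + s * y) * piDens c θ P y
      = (1 - θ) * (1 / (1 + s * c) - 1 + s * c)
        + θ * ((∫ u, Real.exp (-s * u) ∂P) * (1 / (1 + s * c)) - 1 + s * (c + ∫ u, u ∂P)) := by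
  have o := eC_one_integrable hc
  have d := eC_id_integrable hc
  have e := eC_exp_integrable hc hs
  have a0 := hPe.mul_prod e.1
  have a1 := (hPi.const_mul s).mul_prod o.1
  have a2 := (integrable_const (μ := P) s).mul_prod d.1
  have a3 := (integrable_const (μ := P) (1:ℝ)).mul_prod o.1
  have hh : (fun z : ℝ × ℝ => (Real.exp (-s * (z.1 + z.2)) - 1 + s * (z.1 + z.2)) * eC c z.2)
      = fun z => Real.exp (-s * z.1) * (Real.exp (-s * z.2) * eC c z.2) - 1 * eC c z.2
          + s * z.1 * eC c z.2 + s * (z.2 * eC c z.2) := by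
    funext z
    rw [mul_add, Real.exp_add]; ring
  have hh1 : (fun x : ℝ => (Real.exp (-s * x) - 1 + s * x) * eC c x)
      = fun x => Real.exp (-s * x) * eC c x - eC c x + s * (x * eC c x) := by
    funext z
    ring
  have := piDens_int (c := c) (θ := θ) hP0 (f := fun x => Real.exp (-s * x) - 1 + s * x) (by fun_prop)
    (by rw [hh1]; exact (e.1.sub o.1).add (d.1.const_mul s))
    (by rw [hh]; exact ((a0.sub a3).add a1).add a2)
  have b1 : Integrable (fun x => Real.exp (-s * x) * eC c x - eC c x) := e.1.sub o.1
  have b2 : Integrable (fun z : ℝ × ℝ => Real.exp (-s * z.1) * (Real.exp (-s * z.2) * eC c z.2)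
    - 1 * eC c z.2) (P.prod volume) := a0.sub a3
  have b3 : Integrable (fun z : ℝ × ℝ => Real.exp (-s * z.1) * (Real.exp (-s * z.2) * eC c z.2)
    - 1 * eC c z.2 + s * z.1 * eC c z.2) (P.prod volume) := b2.add a1
  rw [this.2, hh, hh1, integral_add b1 (d.1.const_mul s), integral_sub e.1 o.1,
    integral_const_mul, integral_add b3 a2, integral_add b2 a1,
    integral_sub a0 a3,
    integral_prod_mul (fun x : ℝ => s * x) (eC c),
    integral_prod_mul (fun x : ℝ => (1:ℝ)) (eC c),
    integral_prod_mul (fun x : ℝ => s) (fun x => x * eC c x),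
    integral_prod_mul (fun x : ℝ => Real.exp (-s * x)) (fun x => Real.exp (-s * x) * eC c x),
    o.2, d.2, e.2, integral_const_mul]
  simp only [integral_const, probReal_univ, smul_eq_mul]
  ring

lemma eC_nonneg {c : ℝ} (hc : 0 < c) (x : ℝ) : 0 ≤ eC c x := by
  unfold eC
  refine Set.indicator_nonneg (fun x _ => ?_) x
  unfold expDens; positivity

lemma piTailL1_eq {c θ : ℝ} (hc : 0 < c) (hθ : 0 ≤ θ) (hθ1 : θ < 1) {P : Measure ℝ}
    [IsProbabilityMeasure P]
    (hP0 : P (Set.Iic 0) = 0) (hPi : Integrable (fun u => u) P) :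
    piTailL1 c θ P = c + θ * ∫ u, u ∂P := by
  rw [← (piDens_id hc hP0 hPi).2]
  have hi := piDens_one (θ := θ) hc hP0
  have hid := (piDens_id (θ := θ) hc hP0 hPi).1
  have hnn : ∀ y ∈ Set.Ioi (0:ℝ), 0 ≤ piDens c θ P y := by
    intro y hy
    rw [piDens_eq hP0 hy]
    have h1 := eC_nonneg hc y
    have h2 : 0 ≤ ∫ u, eC c (y - u) ∂P := integral_nonneg fun u => eC_nonneg hc _
    have : 0 ≤ 1 - θ := by linarith
    positivity
  set h : ℝ → ENNReal := fun y => ENNReal.ofReal (piDens c θ P y)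
  have hm : AEMeasurable h (volume.restrict (Set.Ioi 0)) := hi.aemeasurable.ennreal_ofReal
  have hlt : ∀ᵐ x ∂(volume.restrict (Set.Ioi (0:ℝ))), h x < ⊤ := by simp [h]
  set μ := (volume.restrict (Set.Ioi (0:ℝ))).withDensity h
  have hμ0 : 0 ≤ᵐ[μ] (fun y : ℝ => y) := by
    refine (withDensity_absolutelyContinuous _ _).ae_le ?_
    filter_upwards [ae_restrict_mem measurableSet_Ioi] with x hx using le_of_lt hx
  have hμi : Integrable (fun y : ℝ => y) μ := by
    rw [integrable_withDensity_iff_integrable_smul₀' hm hlt]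
    refine (integrableOn_congr_fun ?_ measurableSet_Ioi).1 hid
    intro y hy
    simp [h, ENNReal.toReal_ofReal (hnn y hy), mul_comm]
  have key := hμi.integral_eq_integral_meas_lt hμ0
  rw [integral_withDensity_eq_integral_toReal_smul₀ hm hlt] at key
  have k1 : ∫ y in Set.Ioi (0:ℝ), y * piDens c θ P y = ∫ y in Set.Ioi (0:ℝ), (h y).toReal • y := by
    refine setIntegral_congr_fun measurableSet_Ioi ?_
    intro y hy
    simp [h, ENNReal.toReal_ofReal (hnn y hy), mul_comm]
  rw [k1, key]
  unfold piTailL1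
  refine setIntegral_congr_fun measurableSet_Ioi ?_
  intro t ht
  have ht' : (0:ℝ) < t := ht
  have hsub : Set.Ioi t ⊆ Set.Ioi 0 := Set.Ioi_subset_Ioi ht'.le
  have : {a : ℝ | t < a} = Set.Ioi t := rfl
  simp only [piTail, this, measureReal_def, μ]
  rw [withDensity_apply _ measurableSet_Ioi, Measure.restrict_restrict measurableSet_Ioi,
    Set.inter_eq_left.2 hsub, integral_eq_lintegral_of_nonneg_ae]
  · filter_upwards [ae_restrict_mem measurableSet_Ioi] with x hx using hnn x (hsub hx)
  · exact (hi.mono_set hsub).aestronglyMeasurable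

lemma g_nonneg (t : ℝ) : 0 ≤ Real.exp (-t) - 1 + t := by
  have := Real.add_one_le_exp (-t); linarith

lemma g_le_id {t : ℝ} (ht : 0 ≤ t) : Real.exp (-t) - 1 + t ≤ t := by
  have : Real.exp (-t) ≤ 1 := Real.exp_le_one_iff.2 (by linarith)
  linarith

lemma g_le_sq {t : ℝ} (ht : 0 ≤ t) : Real.exp (-t) - 1 + t ≤ t ^ 2 := by
  by_cases h : t ≤ 1
  · have := Real.abs_exp_sub_one_sub_id_le (x := -t) (by rw [abs_neg, abs_of_nonneg ht]; exact h)
    have := (abs_le.1 this).2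
    nlinarith
  · have := g_le_id ht
    nlinarith

lemma g_bound {l y x : ℝ} (hl : 0 ≤ l) (hx : 0 ≤ x) (hxy : x ≤ y) :
    Real.exp (-(l * x)) - 1 + l * x ≤ (l + l ^ 2) * min y (y ^ 2) := by
  have h1 := g_le_id (mul_nonneg hl hx)
  have h2 := g_le_sq (mul_nonneg hl hx)
  have hy : 0 ≤ y := hx.trans hxy
  rcases min_choice y (y ^ 2) with h | h <;> rw [h]
  · nlinarith [mul_le_mul_of_nonneg_left hxy hl, mul_nonneg (sq_nonneg l) hy]
  · have : x ^ 2 ≤ y ^ 2 := by gcongr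
    nlinarith [mul_le_mul_of_nonneg_left this (sq_nonneg l), mul_nonneg hl (sq_nonneg y)]

lemma P_eq {ν P : Measure ℝ} {η : ℝ} {n : ℝ} (hn : 0 < n)
    (hT0 : ν (Set.Ici η) ≠ 0) (hT : ν (Set.Ici η) ≠ ⊤) [IsProbabilityMeasure P]
    (hP0 : P (Set.Iic 0) = 0)
    (htail : ∀ y : ℝ, 0 ≤ y → (P (Set.Ici y)).toReal = tailNu ν (η + y / n) / tailNu ν η) :
    P = (ν (Set.Ici η))⁻¹ • (ν.restrict (Set.Ici η)).map (fun y => n * (y - η)) := by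
  have hfm : Measurable (fun y : ℝ => n * (y - η)) := by fun_prop
  refine Measure.ext_of_Ici _ _ fun a => ?_
  have h2 : ∀ a, ((ν (Set.Ici η))⁻¹ • (ν.restrict (Set.Ici η)).map (fun y => n * (y - η))) (Set.Ici a)
      = (ν (Set.Ici η))⁻¹ * ν (Set.Ici (η + a / n) ∩ Set.Ici η) := by
    intro a
    rw [Measure.smul_apply, Measure.map_apply hfm measurableSet_Ici,
      Measure.restrict_apply (hfm measurableSet_Ici), smul_eq_mul]
    congr 3
    ext y
    simp only [Set.mem_preimage, Set.mem_Ici]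
    rw [← div_le_iff₀' hn]
    constructor <;> intro h <;> linarith
  rw [h2]
  by_cases ha : 0 ≤ a
  · have hle : η ≤ η + a / n := by have : 0 ≤ a / n := by positivity
                                   linarith
    have hsub : Set.Ici (η + a / n) ⊆ Set.Ici η := Set.Ici_subset_Ici.2 hle
    rw [Set.inter_eq_left.2 hsub]
    have hfin : ν (Set.Ici (η + a / n)) ≠ ⊤ := ne_top_of_le_ne_top hT (measure_mono hsub)
    rw [← ENNReal.toReal_eq_toReal_iff' (measure_ne_top _ _)
      (ENNReal.mul_ne_top (ENNReal.inv_ne_top.2 hT0) hfin), htail a ha, ENNReal.toReal_mul,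
      ENNReal.toReal_inv]
    unfold tailNu
    rw [div_eq_inv_mul]
  · push Not at ha
    have hle : η + a / n ≤ η := by
      have : a / n < 0 := div_neg_of_neg_of_pos ha hn
      linarith
    rw [Set.inter_eq_right.2 (Set.Ici_subset_Ici.2 hle), ENNReal.inv_mul_cancel hT0 hT]
    have : P (Set.Iic 0)ᶜ = 1 := by
      rw [prob_compl_eq_one_iff measurableSet_Iic]; exact hP0
    refine le_antisymm prob_le_one ?_
    rw [← this]
    refine measure_mono ?_
    intro x hx
    simp at hx ⊢
    linarith

lemma P_int {ν P : Measure ℝ} {η : ℝ} {n : ℝ}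
    (hP : P = (ν (Set.Ici η))⁻¹ • (ν.restrict (Set.Ici η)).map (fun y => n * (y - η)))
    {f : ℝ → ℝ} (hf : Measurable f) :
    ∫ u, f u ∂P = (tailNu ν η)⁻¹ * ∫ y in Set.Ici η, f (n * (y - η)) ∂ν := by
  rw [hP, integral_smul_measure, integral_map (by fun_prop) hf.aestronglyMeasurable,
    ENNReal.toReal_inv, smul_eq_mul]
  rfl

lemma min_integrable {ν : Measure ℝ}
    (hνint : ∫⁻ y in Set.Ioi (0 : ℝ), ENNReal.ofReal (min y (y ^ 2)) ∂ν ≠ ⊤) :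
    IntegrableOn (fun y : ℝ => min y (y ^ 2)) (Set.Ioi 0) ν := by
  refine ⟨by fun_prop, ?_⟩
  rw [hasFiniteIntegral_iff_ofReal]
  · exact lt_top_iff_ne_top.2 hνint
  · filter_upwards [ae_restrict_mem measurableSet_Ioi] with x hx
    have : (0:ℝ) < x := hx
    simp only [Pi.zero_apply]
    positivity

lemma restr_eq {ν : Measure ℝ} (hν0 : ν (Set.Iic 0) = 0) {η : ℝ} (hη : 0 ≤ η) :
    ν.restrict (Set.Ici η) = (ν.restrict (Set.Ioi 0)).restrict (Set.Ici η) := by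
  rw [Measure.restrict_restrict measurableSet_Ici]
  refine Measure.restrict_congr_set ?_
  have h0 : ∀ᵐ u ∂ν, 0 < u := by
    rw [ae_iff]; convert hν0 using 2; ext; simp
  filter_upwards [h0] with u hu
  apply propext
  show η ≤ u ↔ (η ≤ u ∧ 0 < u)
  tauto

lemma id_integrable {ν : Measure ℝ} (hν0 : ν (Set.Iic 0) = 0)
    (hνint : ∫⁻ y in Set.Ioi (0 : ℝ), ENNReal.ofReal (min y (y ^ 2)) ∂ν ≠ ⊤)
    {η : ℝ} (hη : 0 ≤ η) (hT : ν (Set.Ici η) ≠ ⊤) :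
    IntegrableOn (fun y : ℝ => y - η) (Set.Ici η) ν ∧
    ∀ s : ℝ, 0 < s → ∫ y in Set.Ici η, (y - η) ∂ν ≤
      (1 + s) * (∫ y in Set.Ioi (0:ℝ), min y (y ^ 2) ∂ν) + tailNu ν η / s := by
  have hm := min_integrable hνint
  have hm' : IntegrableOn (fun y : ℝ => min y (y ^ 2)) (Set.Ici η) ν := by
    rw [IntegrableOn, restr_eq hν0 hη]
    exact Integrable.integrableOn hm
  have hpt : ∀ s : ℝ, 0 < s → ∀ y ∈ Set.Ici η, y - η ≤ (1 + s) * min y (y ^ 2) + 1 / s := by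
    intro s hs y hy
    have hy' : η ≤ y := hy
    have h0 : 0 ≤ y := hη.trans hy'
    have hs' : 0 < 1 / s := by positivity
    rcases min_choice y (y ^ 2) with h | h <;> rw [h]
    · nlinarith [mul_nonneg hs.le h0]
    · have hh : s * (1 / s) = 1 := by field_simp
      have : 2 * y ≤ s * y ^ 2 + 1 / s := by
        have := mul_nonneg hs'.le (sq_nonneg (s * y - 1))
        have e : 1 / s * (s * y - 1) ^ 2 = s * y ^ 2 - 2 * y + 1 / s := by field_simp; ring
        linarith
      nlinarith [sq_nonneg y]
  have hc : ∀ s : ℝ, IntegrableOn (fun y : ℝ => (1 + s) * min y (y ^ 2) + 1 / s) (Set.Ici η) ν := by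
    intro s
    exact (hm'.const_mul (1 + s)).add (integrableOn_const hT)
  have hid : IntegrableOn (fun y : ℝ => y - η) (Set.Ici η) ν := by
    refine (hc 1).mono' (by fun_prop) ?_
    filter_upwards [ae_restrict_mem measurableSet_Ici] with y hy
    rw [Real.norm_of_nonneg (sub_nonneg.2 hy)]
    exact hpt 1 one_pos y hy
  refine ⟨hid, fun s hs => ?_⟩
  have h1 := setIntegral_mono_on hid (hc s) measurableSet_Ici (hpt s hs)
  rw [integral_add (hm'.const_mul (1 + s)) (integrableOn_const hT), integral_const_mul] at h1
  have h2 : ∫ y in Set.Ici η, min y (y ^ 2) ∂ν ≤ ∫ y in Set.Ioi (0:ℝ), min y (y ^ 2) ∂ν := by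
    rw [restr_eq hν0 hη]
    refine setIntegral_le_integral hm ?_
    filter_upwards [ae_restrict_mem measurableSet_Ioi] with x hx
    have : (0:ℝ) < x := hx
    simp only [Pi.zero_apply]
    positivity
  have h3 : ∫ y in Set.Ici η, (1 / s) ∂ν = tailNu ν η / s := by
    simp [tailNu, measureReal_def, div_eq_mul_inv]
  rw [h3] at h1
  have := mul_le_mul_of_nonneg_left h2 (by linarith : 0 ≤ 1 + s)
  linarith

lemma I_eq {ν : Measure ℝ} {η : ℝ} 
    (hid : IntegrableOn (fun y : ℝ => y - η) (Set.Ici η) ν) :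
    ∫ y in Set.Ioi (0:ℝ), tailNu ν (η + y) = ∫ y in Set.Ici η, (y - η) ∂ν := by
  rw [Integrable.integral_eq_integral_meas_le hid]
  · refine setIntegral_congr_fun measurableSet_Ioi ?_
    intro t ht
    have ht' : (0:ℝ) < t := ht
    simp only [tailNu, measureReal_def]
    rw [Measure.restrict_apply (measurableSet_le measurable_const (by fun_prop))]
    congr 2
    ext y
    simp only [Set.mem_Ici, Set.mem_inter_iff, Set.mem_ofPred_eq]
    constructor
    · intro h; constructor <;> linarith
    · intro h; linarith [h.1]
  · filter_upwards [ae_restrict_mem measurableSet_Ici] with y hy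
    exact sub_nonneg.2 hy

lemma phiN_eq
    (b c : ℝ) (hc : 0 < c)
    (ν : Measure ℝ) (hν0 : ν (Set.Iic 0) = 0)
    (hνint : ∫⁻ y in Set.Ioi (0 : ℝ), ENNReal.ofReal (min y (y ^ 2)) ∂ν ≠ ⊤)
    (η θ : ℕ → ℝ) (Λ : ℕ → Measure ℝ) (n : ℕ) (hn : 1 ≤ n)
    (hη : 0 ≤ η n) (hθ : 0 ≤ θ n ∧ θ n < 1)
    (hT : tailNu ν (η n) = (n : ℝ) ^ 2 * θ n / c)
    (hTpos : 0 < tailNu ν (η n))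
    (hΛprob : IsProbabilityMeasure (Λ n))
    (hΛsupp : Λ n (Set.Iic 0) = 0)
    (hΛtail : ∀ y : ℝ, 0 ≤ y →
      ((Λ n) (Set.Ici y)).toReal = tailNu ν (η n + y / (n : ℝ)) / tailNu ν (η n))
    (l : ℝ) (hl : 0 ≤ l) (I : ℝ) (hI : I = ∫ y in Set.Ioi (0 : ℝ), tailNu ν (η n + y)) :
    phiN b c ν η θ Λ n l = n * (1 - gam b c ν η n * c * (1 + I / n)) * l +
      gam b c ν η n * (1 / (1 + l * c / n)) * (l ^ 2 * c ^ 2 +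
        c * (∫ y in Set.Ici (η n), (Real.exp (-(l * (y - η n))) - 1 + l * (y - η n)) ∂ν)
          + l ^ 2 * c ^ 2 * (I / n)) := by
  have hn0 : (0:ℝ) < n := by exact_mod_cast hn
  have hT1 := ENNReal.toReal_pos_iff.1 hTpos
  have hT0 : ν (Set.Ici (η n)) ≠ 0 := hT1.1.ne'
  have hTt : ν (Set.Ici (η n)) ≠ ⊤ := hT1.2.ne
  obtain ⟨hid, -⟩ := id_integrable hν0 hνint hη hTt
  have hIe := hI.trans (I_eq hid)
  have hP := P_eq hn0 hT0 hTt hΛsupp hΛtail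
  have hPi : Integrable (fun u => u) (Λ n) := by
    rw [hP]
    refine Integrable.smul_measure ?_ (ENNReal.inv_ne_top.2 hT0)
    rw [integrable_map_measure (by fun_prop) (by fun_prop)]
    exact hid.const_mul _
  have hs : 0 ≤ l / n := by positivity
  have h0 : ∀ᵐ u ∂(Λ n), 0 < u := by
    rw [ae_iff]; convert hΛsupp using 2; ext; simp
  have hPe : Integrable (fun u => Real.exp (-(l / n) * u)) (Λ n) := by
    refine (integrable_const (1:ℝ)).mono' (by fun_prop) ?_
    filter_upwards [h0] with u hu
    rw [Real.norm_of_nonneg (Real.exp_pos _).le, Real.exp_le_one_iff]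
    have := mul_nonneg hs hu.le
    linarith
  have hM := P_int hP (f := fun u => u) measurable_id
  have hG := P_int hP (f := fun u => Real.exp (-(l / n) * u) - 1 + (l / n) * u) (by fun_prop)
  have hL : ∫ u, (Real.exp (-(l / n) * u) - 1 + (l / n) * u) ∂(Λ n)
      = (∫ u, Real.exp (-(l / n) * u) ∂(Λ n)) - 1 + (l/n) * ∫ u, u ∂(Λ n) := by
    have b1 : Integrable (fun u => Real.exp (-(l / n) * u) - 1) (Λ n) := hPe.sub (integrable_const 1)
    rw [integral_add b1 (hPi.const_mul _), integral_sub hPe (integrable_const 1), integral_const_mul]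
    simp
  rw [integral_const_mul, ← hIe] at hM
  have hJ : ∫ y in Set.Ici (η n), (Real.exp (-(l / n) * (n * (y - η n))) - 1 + (l / n) * (n * (y - η n))) ∂ν
      = ∫ y in Set.Ici (η n), (Real.exp (-(l * (y - η n))) - 1 + l * (y - η n)) ∂ν := by
    congr 1; funext y
    have : (l / n) * (n * (y - η n)) = l * (y - η n) := by field_simp
    rw [neg_mul, this]
  rw [hJ] at hG
  set J := ∫ y in Set.Ici (η n), (Real.exp (-(l * (y - η n))) - 1 + l * (y - η n)) ∂ν
  have hmain := piDens_g (θ := θ n) hc hs hΛsupp hPi hPe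
  have hform : ∫ y in Set.Ioi (0 : ℝ),
        (Real.exp (-l * y / (n : ℝ)) - 1 + l * y / (n : ℝ)) * piDens c (θ n) (Λ n) y =
      ∫ y in Set.Ioi (0:ℝ), (Real.exp (-(l / n) * y) - 1 + (l / n) * y) * piDens c (θ n) (Λ n) y := by
    congr 1; funext y
    rw [show -l * y / (n:ℝ) = -(l / n) * y by ring, show l * y / (n:ℝ) = (l / n) * y by ring]
  unfold phiN
  rw [hform, hmain, piTailL1_eq hc hθ.1 hθ.2 hΛsupp hPi]
  rw [hL] at hG
  have hL' : ∫ u, Real.exp (-(l / n) * u) ∂(Λ n) = (tailNu ν (η n))⁻¹ * J + 1 - (l/n) * ∫ u, u ∂(Λ n) := by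
    linarith
  rw [hL', hM]
  have hθe : θ n = c * tailNu ν (η n) / n ^ 2 := by rw [hT]; field_simp
  rw [hθe]
  generalize tailNu ν (η n) = T at hTpos
  generalize gam b c ν η n = γ
  have : 0 < 1 + l * c / n := by positivity
  have : 0 < n + l * c := by positivity
  field_simp
  ring

lemma J_tendsto {ν : Measure ℝ} (hν0 : ν (Set.Iic 0) = 0)
    (hνint : ∫⁻ y in Set.Ioi (0 : ℝ), ENNReal.ofReal (min y (y ^ 2)) ∂ν ≠ ⊤)
    {η : ℕ → ℝ} (hη : ∀ n, 0 ≤ η n) (hη0 : Tendsto η atTop (𝓝 0)) {l : ℝ} (hl : 0 ≤ l) :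
    Tendsto (fun n => ∫ y in Set.Ici (η n), (Real.exp (-(l * (y - η n))) - 1 + l * (y - η n)) ∂ν)
      atTop (𝓝 (∫ y in Set.Ioi (0 : ℝ), (Real.exp (-l * y) - 1 + l * y) ∂ν)) := by
  have hm := min_integrable hνint
  have he : ∀ n, ∫ y in Set.Ici (η n), (Real.exp (-(l * (y - η n))) - 1 + l * (y - η n)) ∂ν
      = ∫ y in Set.Ioi (0:ℝ), (Set.Ici (η n)).indicator
        (fun y => Real.exp (-(l * (y - η n))) - 1 + l * (y - η n)) y ∂ν := by
    intro n
    rw [restr_eq hν0 (hη n), integral_indicator measurableSet_Ici]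
  simp only [he]
  refine tendsto_integral_of_dominated_convergence (fun y => (l + l ^ 2) * min y (y ^ 2)) ?_
    (hm.const_mul _) ?_ ?_
  · intro n
    refine Measurable.aestronglyMeasurable (Measurable.indicator (by fun_prop) measurableSet_Ici)
  · intro n
    filter_upwards [ae_restrict_mem measurableSet_Ioi] with y hy
    have hy' : (0:ℝ) < y := hy
    by_cases h : y ∈ Set.Ici (η n)
    · rw [Set.indicator_of_mem h, Real.norm_of_nonneg (g_nonneg _)]
      exact g_bound hl (sub_nonneg.2 h) (by linarith [hη n])
    · rw [Set.indicator_of_notMem h, norm_zero]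
      positivity
  · filter_upwards [ae_restrict_mem measurableSet_Ioi] with y hy
    have hy' : (0:ℝ) < y := hy
    have hc : Tendsto (fun n => Real.exp (-(l * (y - η n))) - 1 + l * (y - η n)) atTop
        (𝓝 (Real.exp (-(l * (y - 0))) - 1 + l * (y - 0))) := by
      have : Continuous (fun x : ℝ => Real.exp (-(l * (y - x))) - 1 + l * (y - x)) := by fun_prop
      exact (this.tendsto 0).comp hη0
    rw [sub_zero, ← neg_mul] at hc
    refine hc.congr' ?_
    filter_upwards [hη0.eventually (gt_mem_nhds hy')] with n hn
    rw [Set.indicator_of_mem (show y ∈ Set.Ici (η n) from hn.le)]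

/-- Proposition 3.5: `Φ⁽ⁿ⁾(λ) → Φ(λ)` for every `λ ≥ 0`. -/
theorem stmt6
    (b c : ℝ) (hb : 0 ≤ b) (hc : 0 < c)
    (ν : Measure ℝ) (hν0 : ν (Set.Iic 0) = 0)
    (hνint : ∫⁻ y in Set.Ioi (0 : ℝ), ENNReal.ofReal (min y (y ^ 2)) ∂ν ≠ ⊤)
    (η θ : ℕ → ℝ) (hη : ∀ n : ℕ, 0 ≤ η n) (hθ : ∀ n : ℕ, 0 ≤ θ n ∧ θ n < 1)
    (hseq : (ν (Set.Ici (0 : ℝ)) ≠ ⊤ ∧ (∀ n : ℕ, 1 ≤ n → η n = 0) ∧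
        (∀ n : ℕ, 1 ≤ n → θ n = c * tailNu ν 0 / (n : ℝ) ^ 2)) ∨
      (ν (Set.Ici (0 : ℝ)) = ⊤ ∧
        Filter.Tendsto (fun n : ℕ => (n : ℝ) * θ n) Filter.atTop (nhds 0) ∧
        Filter.Tendsto (fun n : ℕ => (n : ℝ) ^ 2 * θ n) Filter.atTop Filter.atTop ∧
        (∀ n : ℕ, 1 ≤ n → tailNu ν (η n) = (n : ℝ) ^ 2 * θ n / c)))
    (Λ : ℕ → Measure ℝ)
    (hΛprob : ∀ n : ℕ, 1 ≤ n → IsProbabilityMeasure (Λ n))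
    (hΛsupp : ∀ n : ℕ, 1 ≤ n → Λ n (Set.Iic 0) = 0)
    (hΛtail : ∀ n : ℕ, 1 ≤ n → ∀ y : ℝ, 0 ≤ y →
      ((Λ n) (Set.Ici y)).toReal = tailNu ν (η n + y / (n : ℝ)) / tailNu ν (η n))
    :
    ∀ l : ℝ, 0 ≤ l →
      Filter.Tendsto (fun n : ℕ => phiN b c ν η θ Λ n l) Filter.atTop (nhds (phi b c ν l)) := by
  intro l hl
  have hT : ∀ n : ℕ, 1 ≤ n → tailNu ν (η n) = (n : ℝ) ^ 2 * θ n / c := by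
    rcases hseq with ⟨-, h1, h2⟩ | ⟨-, -, -, h⟩
    · intro n hn
      have : (0:ℝ) < n := by exact_mod_cast hn
      rw [h1 n hn, h2 n hn]
      field_simp
    · exact h
  have hTpos : ∀ n : ℕ, 1 ≤ n → 0 < tailNu ν (η n) := by
    intro n hn
    have := hΛprob n hn
    refine lt_of_le_of_ne ENNReal.toReal_nonneg fun h0 => ?_
    have h1 := hΛtail n hn 0 le_rfl
    rw [← h0, div_zero] at h1
    have h2 : Λ n (Set.Ici 0) = 0 := by
      rcases (ENNReal.toReal_eq_zero_iff _).1 h1 with h | h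
      · exact h
      · exact absurd h (measure_ne_top _ _)
    have h3 : Λ n Set.univ = 0 := by
      rw [← Set.Iic_union_Ici (a := (0:ℝ))]
      exact measure_union_null (hΛsupp n hn) h2
    simp at h3
  have hTfin : ∀ n : ℕ, 1 ≤ n → ν (Set.Ici (η n)) ≠ ⊤ := fun n hn =>
    (ENNReal.toReal_pos_iff.1 (hTpos n hn)).2.ne
  have hnθ : Tendsto (fun n : ℕ => (n : ℝ) * θ n) atTop (𝓝 0) := by
    rcases hseq with ⟨-, h1, h2⟩ | ⟨-, h, -, -⟩
    · have : Tendsto (fun n : ℕ => (c * tailNu ν 0) / (n:ℝ)) atTop (𝓝 0) :=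
        tendsto_const_div_atTop_nhds_zero_nat _
      refine this.congr' ?_
      filter_upwards [eventually_ge_atTop 1] with n hn
      have : (0:ℝ) < n := by exact_mod_cast hn
      rw [h2 n hn]
      field_simp
    · exact h
  have hm := min_integrable hνint
  have hη0 : Tendsto η atTop (𝓝 0) := by
    rcases hseq with ⟨-, h1, -⟩ | ⟨-, -, h2, -⟩
    · refine tendsto_const_nhds.congr' ?_
      filter_upwards [eventually_ge_atTop 1] with n hn
      exact (h1 n hn).symm
    · rw [Metric.tendsto_atTop']
      intro ε hε
      have hfin : ν (Set.Ici ε) ≠ ⊤ := by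
        have hmp : 0 < min ε (ε ^ 2) := by positivity
        have h3 := hm.measure_norm_ge_lt_top hmp
        have h4 : ν (Set.Ici ε) ≤ (ν.restrict (Set.Ioi 0)) {a | min ε (ε ^ 2) ≤ ‖min a (a ^ 2)‖} := by
          have : (ν.restrict (Set.Ioi 0)) (Set.Ici ε) = ν (Set.Ici ε) := by
            rw [Measure.restrict_apply measurableSet_Ici]
            congr 1
            refine Set.inter_eq_left.2 fun x hx => ?_
            exact lt_of_lt_of_le hε hx
          rw [← this]
          refine measure_mono fun x hx => ?_
          have hx' : ε ≤ x := hx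
          show min ε (ε ^ 2) ≤ ‖min x (x ^ 2)‖
          refine le_trans ?_ (Real.le_norm_self _)
          gcongr
        exact (lt_of_le_of_lt h4 h3).ne
      obtain ⟨N, hN⟩ := (h2.eventually_gt_atTop (c * tailNu ν ε)).exists_forall_of_atTop
      refine ⟨max N 1, fun n hn => ?_⟩
      have hn1 : 1 ≤ n := ((le_max_right N 1).trans_lt hn).le
      have hnN := hN n ((le_max_left N 1).trans hn.le)
      rw [Real.dist_eq, sub_zero, abs_of_nonneg (hη n)]
      by_contra hcon
      push Not at hcon
      have h5 : tailNu ν (η n) ≤ tailNu ν ε :=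
        ENNReal.toReal_mono hfin (measure_mono (Set.Ici_subset_Ici.2 hcon))
      rw [hT n hn1, div_le_iff₀ hc] at h5
      linarith
  set I : ℕ → ℝ := fun n => ∫ y in Set.Ioi (0 : ℝ), tailNu ν (η n + y) with hIdef
  set K := ∫ y in Set.Ioi (0:ℝ), min y (y ^ 2) ∂ν
  have hI0 : ∀ n, 0 ≤ I n := fun n => integral_nonneg fun y => ENNReal.toReal_nonneg
  have hinv : Tendsto (fun n : ℕ => 1 / √(n:ℝ)) atTop (𝓝 0) := by
    have := (Real.tendsto_sqrt_atTop.comp (tendsto_natCast_atTop_atTop (R := ℝ))).inv_tendsto_atTop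
    refine this.congr fun n => ?_
    simp
  have hTn : Tendsto (fun n : ℕ => √((n : ℝ) * θ n / c)) atTop (𝓝 0) := by
    have := (hnθ.div_const c).sqrt
    simpa using this
  have hR : Tendsto (fun n : ℕ => I n / √(n:ℝ)) atTop (𝓝 0) := by
    have hub : Tendsto (fun n : ℕ => K * (1 / √(n:ℝ)) + (K + 1) * √((n : ℝ) * θ n / c)) atTop (𝓝 0) := by
      simpa using (hinv.const_mul K).add (hTn.const_mul (K + 1))
    refine tendsto_of_tendsto_of_tendsto_of_le_of_le' tendsto_const_nhds hub ?_ ?_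
    · exact Eventually.of_forall fun n => div_nonneg (hI0 n) (Real.sqrt_nonneg _)
    · filter_upwards [eventually_ge_atTop 1] with n hn
      have hn0 : (0:ℝ) < n := by exact_mod_cast hn
      obtain ⟨hid, hbd⟩ := id_integrable hν0 hνint (hη n) (hTfin n hn)
      have hs := Real.sqrt_pos.2 (hTpos n hn)
      have h1 := hbd _ hs
      rw [← I_eq hid, Real.div_sqrt] at h1
      have hsq : √(tailNu ν (η n)) = √((n : ℝ) * θ n / c) * √(n:ℝ) := by
        rw [hT n hn, ← Real.sqrt_mul (by have := (hθ n).1; positivity)]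
        congr 1; ring
      have hns : 0 < √(n:ℝ) := Real.sqrt_pos.2 hn0
      rw [div_le_iff₀ hns]
      have e : (K * (1 / √(n:ℝ)) + (K + 1) * √((n : ℝ) * θ n / c)) * √(n:ℝ)
          = K + (K + 1) * (√((n : ℝ) * θ n / c) * √(n:ℝ)) := by
        field_simp
      rw [e, ← hsq]
      show (∫ y in Set.Ioi (0 : ℝ), tailNu ν (η n + y)) ≤ _
      linarith
  have hIn : Tendsto (fun n : ℕ => I n / n) atTop (𝓝 0) := by
    have := hR.mul hinv
    rw [mul_zero] at this
    refine this.congr fun n => ?_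
    rw [div_mul_div_comm, mul_one, Real.mul_self_sqrt (Nat.cast_nonneg n)]
  have hI2 : Tendsto (fun n : ℕ => I n ^ 2 / n) atTop (𝓝 0) := by
    have := hR.mul hR
    rw [mul_zero] at this
    refine this.congr fun n => ?_
    rw [div_mul_div_comm, Real.mul_self_sqrt (Nat.cast_nonneg n), sq]
  have hbn : Tendsto (fun n : ℕ => b / (n:ℝ)) atTop (𝓝 0) := tendsto_const_div_atTop_nhds_zero_nat b
  have hδ : Tendsto (fun n : ℕ => 1 - b / (n:ℝ) - I n / n) atTop (𝓝 1) := by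
    simpa using (hbn.const_sub 1).sub hIn
  have hγ : ∀ᶠ n : ℕ in atTop, gam b c ν η n = (1 / c) * (1 - b / (n:ℝ) - I n / n) := by
    filter_upwards [hδ.eventually (lt_mem_nhds one_pos)] with n hn
    unfold gam
    have : (1 / (n : ℝ)) * ∫ y in Set.Ioi (0 : ℝ), tailNu ν (η n + y) = I n / n := by
      rw [one_div_mul_eq_div]
    rw [this, max_eq_right hn.le]
  have hq : Tendsto (fun n : ℕ => 1 / (1 + l * c / (n:ℝ))) atTop (𝓝 1) := by
    have h1 : Tendsto (fun n : ℕ => 1 + l * c / (n:ℝ)) atTop (𝓝 1) := by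
      simpa using (tendsto_const_div_atTop_nhds_zero_nat (l * c)).const_add 1
    simpa using h1.inv₀ one_ne_zero
  have hJ := J_tendsto hν0 hνint hη hη0 hl
  have hlim := (((hIn.const_mul b).const_add b).add hI2).mul_const l |>.add
    (((hδ.const_mul (1 / c)).mul hq).mul
      (((hJ.const_mul c).const_add (l ^ 2 * c ^ 2)).add (hIn.const_mul (l ^ 2 * c ^ 2))))
  have hval : phi b c ν l = (b + b * 0 + 0) * l + 1 / c * 1 * 1 * (l ^ 2 * c ^ 2 +
      c * (∫ y in Set.Ioi (0 : ℝ), (Real.exp (-l * y) - 1 + l * y) ∂ν) + l ^ 2 * c ^ 2 * 0) := by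
    unfold phi
    field_simp
    ring
  rw [hval]
  refine hlim.congr' ?_
  filter_upwards [hγ, eventually_ge_atTop 1] with n hg hn
  have hn0 : (0:ℝ) < n := by exact_mod_cast hn
  rw [phiN_eq b c hc ν hν0 hνint η θ Λ n hn (hη n) (hθ n) (hT n hn) (hTpos n hn) (hΛprob n hn)
    (hΛsupp n hn) (hΛtail n hn) l hl (I n) rfl, hg]
  congr 1
  field_simp
  ring
end

section
/- For every n ≥ 1, every t ≥ 0 and every y > 0 one has R_{Π_n}(t) ≤ 1/c and R_n(t, y) ≤ 1 + (t ∧ y)/c; in particular these two bounds hold uniformly in n. -/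
open MeasureTheory Real Set Filter Topology

noncomputable def convPos (f g : ℝ → ℝ) (x : ℝ) : ℝ := ∫ y in (0 : ℝ)..x, f (x - y) * g y

noncomputable def convIter (f : ℝ → ℝ) : ℕ → ℝ → ℝ
  | 0 => f
  | k + 1 => convPos f (convIter f k)

/-- Resolvent of the second kind of `f`: the sum `Σ_{k≥1} f^{*k}`, set to `0` on `(−∞,0)`. -/
noncomputable def resolventSnd (f : ℝ → ℝ) (t : ℝ) : ℝ :=
  if t < 0 then 0 else ∑' k : ℕ, convIter f k t

noncomputable def RPi (b c : ℝ) (ν : Measure ℝ) (η θ : ℕ → ℝ) (Λ : ℕ → Measure ℝ)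
    (n : ℕ) : ℝ → ℝ :=
  resolventSnd (fun t => gam b c ν η n * piTail c (θ n) (Λ n) t)

noncomputable def Rtwo (b c : ℝ) (ν : Measure ℝ) (η θ : ℕ → ℝ) (Λ : ℕ → Measure ℝ)
    (n : ℕ) (t y : ℝ) : ℝ :=
  if t < 0 ∨ y < 0 then 0
  else (if t < y then 1 else 0) + ∫ s in (t - y)..t, RPi b c ν η θ Λ n s


noncomputable def kk (c z : ℝ) : ℝ := Real.exp (-(max z 0) / c)

lemma kk_cont (c : ℝ) : Continuous (kk c) := by unfold kk; fun_prop

lemma kk_nonneg (c z : ℝ) : 0 ≤ kk c z := (Real.exp_pos _).le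

lemma kk_le (c : ℝ) (hc : 0 < c) (z : ℝ) : kk c z ≤ 1 := by
  unfold kk
  rw [Real.exp_le_one_iff, neg_div]
  have : 0 ≤ max z 0 / c := div_nonneg (le_max_right _ _) hc.le
  linarith

lemma kk_int (c : ℝ) (hc : 0 < c) (u t : ℝ) (hu : 0 ≤ u) (ht : 0 ≤ t) :
    c * kk c (t - u) + ∫ s in (0 : ℝ)..t, kk c (s - u) = c + min t u := by
  have h1 : ∀ r, 0 ≤ r → r ≤ u → ∫ s in (0 : ℝ)..r, kk c (s - u) = r := by
    intro r hr hru
    rw [intervalIntegral.integral_congr (g := fun _ => (1 : ℝ))]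
    · simp
    · intro s hs
      rw [uIcc_of_le hr] at hs
      have : s - u ≤ 0 := by linarith [hs.2]
      simp [kk, max_eq_right this]
  rcases le_total t u with h | h
  · rw [h1 t ht h, min_eq_left h]
    have : t - u ≤ 0 := by linarith
    simp [kk, max_eq_right this]
  · have hI : ∀ a b, IntervalIntegrable (fun s => kk c (s - u)) volume a b := fun a b =>
      ((kk_cont c).comp (continuous_id.sub continuous_const)).intervalIntegrable a b
    rw [← intervalIntegral.integral_add_adjacent_intervals (hI 0 u) (hI u t), h1 u hu le_rfl,
      min_eq_right h]
    have h2 : ∫ s in u..t, kk c (s - u) = ∫ s in u..t, Real.exp (-(s-u)/c) := by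
      apply intervalIntegral.integral_congr
      intro s hs
      rw [uIcc_of_le h] at hs
      have : 0 ≤ s - u := by linarith [hs.1]
      simp [kk, max_eq_left this]
    have h3 : ∫ s in u..t, Real.exp (-(s-u)/c) =
        (-c * Real.exp (-(t-u)/c)) - (-c * Real.exp (-(u-u)/c)) := by
      apply intervalIntegral.integral_eq_sub_of_hasDerivAt
      · intro x _
        have : HasDerivAt (fun s : ℝ => -(s-u)/c) (-1/c) x :=
          (((hasDerivAt_id x).sub_const u).neg).div_const c
        have := (this.exp).const_mul (-c)
        have e : -c * (Real.exp (-(x-u)/c) * (-1/c)) = Real.exp (-(x-u)/c) := by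
          field_simp
        rw [e] at this
        exact this
      · exact (by fun_prop : Continuous fun s => Real.exp (-(s-u)/c)).intervalIntegrable _ _
    rw [h2, h3]
    have : 0 ≤ t - u := by linarith
    simp [kk, max_eq_left this]
    ring

noncomputable def GG (c y u : ℝ) : ℝ := (Set.Ici u).indicator (fun y => expDens c (y - u)) y

lemma expD_eq (c u y : ℝ) : expDens c (y - u) =
    (1/c * Real.exp (u/c)) * Real.exp ((-1/c) * y) := by
  unfold expDens
  rw [mul_assoc, ← Real.exp_add]
  congr 2
  ring

lemma expD_int (c : ℝ) (hc : 0 < c) (u x : ℝ) :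
    IntegrableOn (fun y => expDens c (y - u)) (Ioi x) := by
  simp_rw [expD_eq]
  exact (integrableOn_exp_mul_Ioi (div_neg_of_neg_of_pos (by norm_num) hc) x).const_mul _

lemma GG_int (c : ℝ) (hc : 0 < c) (u x : ℝ) :
    IntegrableOn (fun y => GG c y u) (Ioi x) :=
  (expD_int c hc u x).indicator measurableSet_Ici

lemma GG_val (c : ℝ) (hc : 0 < c) (u x : ℝ) :
    ∫ y in Ioi x, GG c y u = kk c (x - u) := by
  unfold GG
  rw [setIntegral_indicator measurableSet_Ici]
  have h : (Ioi x ∩ Ici u : Set ℝ) =ᵐ[volume] Ioi (max x u) := by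
    rw [← Ioi_inter_Ioi]
    exact (ae_eq_refl _).inter Ioi_ae_eq_Ici.symm
  rw [setIntegral_congr_set h]
  simp_rw [expD_eq]
  rw [integral_const_mul, integral_exp_mul_Ioi (div_neg_of_neg_of_pos (by norm_num) hc)]
  have : max (x - u) 0 = max x u - u := by
    rw [← max_sub_sub_right, sub_self]
  unfold kk
  rw [this]
  have e : -(max x u - u)/c = u/c + (-1/c) * max x u := by ring
  rw [e, Real.exp_add]
  field_simp

lemma GG_nonneg (c : ℝ) (hc : 0 < c) (y u : ℝ) : 0 ≤ GG c y u := by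
  unfold GG
  apply indicator_nonneg
  intro y _
  unfold expDens
  positivity

lemma GG_meas (c : ℝ) : Measurable (Function.uncurry (GG c)) := by
  have : Function.uncurry (GG c) =
      ({p : ℝ × ℝ | p.2 ≤ p.1}).indicator (fun p => expDens c (p.1 - p.2)) := by
    ext ⟨y, u⟩
    simp [GG, indicator, Function.uncurry]
  rw [this]
  apply Measurable.indicator
  · unfold expDens; fun_prop
  · exact measurableSet_le measurable_snd measurable_fst

lemma kk_integrable (c : ℝ) (hc : 0 < c) (L : Measure ℝ) [IsProbabilityMeasure L] (x : ℝ) :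
    Integrable (fun u => kk c (x - u)) L := by
  apply Integrable.of_bound
    (((kk_cont c).comp (continuous_const.sub continuous_id)).aestronglyMeasurable) 1
  filter_upwards with u
  simpa [abs_of_nonneg (kk_nonneg c _)] using! kk_le c hc (x - u)

noncomputable def PP (c θ : ℝ) (L : Measure ℝ) (x : ℝ) : ℝ :=
  (1 - θ) * kk c x + θ * ∫ u, kk c (x - u) ∂L

lemma piTail_eq (c : ℝ) (hc : 0 < c) (θ : ℝ) (L : Measure ℝ) [IsProbabilityMeasure L]
    (hL : L (Iic 0) = 0) (x : ℝ) (hx : 0 ≤ x) : piTail c θ L x = PP c θ L x := by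
  have hpos : ∀ᵐ u ∂L, 0 < u := by
    rw [ae_iff]
    convert hL using 2
    ext u; simp
  have hI : Integrable (Function.uncurry (GG c)) ((volume.restrict (Ioi x)).prod L) := by
    rw [integrable_prod_iff' (GG_meas c).aestronglyMeasurable]
    constructor
    · filter_upwards with u
      exact GG_int c hc u x
    · have : (fun u => ∫ y in Ioi x, ‖Function.uncurry (GG c) (y, u)‖) =
          fun u => kk c (x - u) := by
        ext u
        rw [← GG_val c hc u x]
        apply integral_congr_ae
        filter_upwards with y
        exact abs_of_nonneg (GG_nonneg c hc y u)
      rw [this]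
      exact kk_integrable c hc L x
  have hd : ∀ y, piDens c θ L y = (1 - θ) * expDens c (y - 0) + θ * ∫ u, GG c y u ∂L := by
    intro y
    unfold piDens
    rw [sub_zero]
    congr 2
    rw [← integral_indicator measurableSet_Icc]
    apply integral_congr_ae
    filter_upwards [hpos] with u hu
    simp [GG, indicator, hu.le]
  unfold piTail PP
  simp_rw [hd]
  have hI' : Integrable (fun y => ∫ u, GG c y u ∂L) (volume.restrict (Ioi x)) :=
    hI.integral_prod_left
  rw [integral_add ((expD_int c hc 0 x).const_mul _) (hI'.const_mul _),
    integral_const_mul, integral_const_mul, integral_integral_swap hI]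
  simp_rw [GG_val c hc]
  congr 2
  rw [← sub_zero x, ← GG_val c hc 0 x, sub_zero]
  apply setIntegral_congr_fun measurableSet_Ioi
  intro y hy
  have : (0:ℝ) ≤ y := hx.trans (le_of_lt hy)
  simp [GG, indicator, this]

lemma PP_cont (c : ℝ) (hc : 0 < c) (θ : ℝ) (L : Measure ℝ) [IsProbabilityMeasure L] :
    Continuous (PP c θ L) := by
  unfold PP
  have : Continuous fun x => ∫ u, kk c (x - u) ∂L := by
    apply continuous_of_dominated (bound := fun _ => (1 : ℝ))
    · intro x
      exact (kk_integrable c hc L x).1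
    · intro x
      filter_upwards with u
      simpa [abs_of_nonneg (kk_nonneg c _)] using! kk_le c hc (x - u)
    · exact integrable_const _
    · filter_upwards with u
      exact (kk_cont c).comp (continuous_id.sub continuous_const)
  exact (continuous_const.mul (kk_cont c)).add (continuous_const.mul this)

lemma PP_nonneg (c θ : ℝ) (h0 : 0 ≤ θ) (h1 : θ < 1) (L : Measure ℝ) (x : ℝ) :
    0 ≤ PP c θ L x := by
  unfold PP
  have := integral_nonneg (μ := L) (f := fun u => kk c (x - u)) (fun u => kk_nonneg c _)
  have h2 := kk_nonneg c x
  have : 0 ≤ 1 - θ := by linarith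
  positivity

lemma PP_int (c : ℝ) (hc : 0 < c) (θ : ℝ) (L : Measure ℝ) [IsProbabilityMeasure L]
    (hL : L (Iic 0) = 0) (t : ℝ) (ht : 0 ≤ t) :
    c * PP c θ L t + ∫ s in (0:ℝ)..t, PP c θ L s = c + θ * ∫ u, min t u ∂L := by
  have hpos : ∀ᵐ u ∂L, 0 < u := by
    rw [ae_iff]
    convert hL using 2
    ext u; simp
  have hI : Integrable (Function.uncurry fun s u => kk c (s - u))
      ((volume.restrict (uIoc 0 t)).prod L) := by
    rw [uIoc_of_le ht]
    apply Integrable.of_bound (C := 1)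
    · exact ((kk_cont c).comp (continuous_fst.sub continuous_snd)).aestronglyMeasurable
    · filter_upwards with p
      change |kk c (p.1 - p.2)| ≤ 1
      rw [abs_of_nonneg (kk_nonneg c _)]
      exact kk_le c hc (p.1 - p.2)
  have hI2 : IntervalIntegrable (fun s => ∫ u, kk c (s - u) ∂L) volume 0 t := by
    rw [intervalIntegrable_iff]
    exact hI.integral_prod_left
  unfold PP
  rw [intervalIntegral.integral_add (((kk_cont c).intervalIntegrable _ _).const_mul _)
    (hI2.const_mul _), intervalIntegral.integral_const_mul, intervalIntegral.integral_const_mul,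
    intervalIntegral_integral_swap hI]
  have h0 := kk_int c hc 0 t le_rfl ht
  simp only [sub_zero, min_eq_right ht, add_zero] at h0
  have hI3 : Integrable (fun u => ∫ s in (0:ℝ)..t, kk c (s - u)) L := by
    have := hI.integral_prod_right
    simpa [intervalIntegral.integral_of_le ht, uIoc_of_le ht] using! this
  have h1 : c * ∫ u, kk c (t - u) ∂L + ∫ u, (∫ s in (0:ℝ)..t, kk c (s - u)) ∂L =
      c + ∫ u, min t u ∂L := by
    rw [← integral_const_mul, ← integral_add ((kk_integrable c hc L t).const_mul _) hI3]
    have hm : Integrable (fun u => min t u) L := by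
      apply Integrable.of_bound (C := t) (by fun_prop)
      filter_upwards [hpos] with u hu
      rw [Real.norm_of_nonneg (le_min ht hu.le)]
      exact min_le_left _ _
    have hcc : c + ∫ u, min t u ∂L = ∫ u, (c + min t u) ∂L := by
      rw [integral_add (integrable_const _) hm]; simp
    rw [hcc]
    apply integral_congr_ae
    filter_upwards [hpos] with u hu
    exact kk_int c hc u t hu.le ht
  linear_combination (1 - θ) * h0 + θ * h1

lemma convIter_cont (f : ℝ → ℝ) (hf : Continuous f) (k : ℕ) : Continuous (convIter f k) := by
  induction k with
  | zero => exact hf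
  | succ k ih =>
    change Continuous fun x => ∫ y in (0 : ℝ)..x, f (x - y) * convIter f k y
    apply intervalIntegral.continuous_parametric_intervalIntegral_of_continuous
    · exact (hf.comp (continuous_fst.sub continuous_snd)).mul (ih.comp continuous_snd)
    · exact continuous_id

lemma convIter_nonneg (f : ℝ → ℝ) (hf : ∀ t, 0 ≤ t → 0 ≤ f t) (k : ℕ) :
    ∀ t, 0 ≤ t → 0 ≤ convIter f k t := by
  induction k with
  | zero => exact hf
  | succ k ih =>
    intro t ht
    apply intervalIntegral.integral_nonneg ht
    intro y hy
    exact mul_nonneg (hf _ (by linarith [hy.2])) (ih y hy.1)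

lemma convIter_congr (f g : ℝ → ℝ) (hf : ∀ t, 0 ≤ t → f t = g t) (k : ℕ) :
    ∀ t, 0 ≤ t → convIter f k t = convIter g k t := by
  induction k with
  | zero => exact hf
  | succ k ih =>
    intro t ht
    apply intervalIntegral.integral_congr
    intro y hy
    rw [uIcc_of_le ht] at hy
    simp only
    rw [hf _ (by linarith [hy.2]), ih y hy.1]

lemma partial_le (c : ℝ) (hc : 0 < c) (f : ℝ → ℝ) (hf : Continuous f)
    (hf0 : ∀ t, 0 ≤ t → 0 ≤ f t)
    (hb : ∀ t, 0 ≤ t → c * f t + ∫ s in (0:ℝ)..t, f s ≤ 1) (N : ℕ) :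
    ∀ t, 0 ≤ t → ∑ k ∈ Finset.range N, convIter f k t ≤ 1 / c := by
  induction N with
  | zero => intro t _; simp; positivity
  | succ N ih =>
    intro t ht
    rw [Finset.sum_range_succ']
    have h1 : ∑ k ∈ Finset.range N, convIter f (k+1) t =
        ∫ y in (0:ℝ)..t, ∑ k ∈ Finset.range N, f (t - y) * convIter f k y := by
      rw [intervalIntegral.integral_finsetSum]
      · rfl
      · intro k _
        exact ((hf.comp (continuous_const.sub continuous_id)).mul
          (convIter_cont f hf k)).intervalIntegrable _ _
    have h2 : ∫ y in (0:ℝ)..t, ∑ k ∈ Finset.range N, f (t - y) * convIter f k y ≤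
        ∫ y in (0:ℝ)..t, f (t - y) * (1 / c) := by
      apply intervalIntegral.integral_mono_on ht
      · apply Continuous.intervalIntegrable
        apply continuous_finsetSum
        intro k _
        exact ((hf.comp (continuous_const.sub continuous_id)).mul (convIter_cont f hf k))
      · apply Continuous.intervalIntegrable
        exact ((hf.comp (continuous_const.sub continuous_id)).mul continuous_const)
      · intro y hy
        rw [← Finset.mul_sum]
        exact mul_le_mul_of_nonneg_left (ih y hy.1) (hf0 _ (by linarith [hy.2]))
    have h3 : ∫ y in (0:ℝ)..t, f (t - y) * (1 / c) = (∫ s in (0:ℝ)..t, f s) * (1 / c) := by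
      rw [intervalIntegral.integral_mul_const, intervalIntegral.integral_comp_sub_left]
      simp
    have h4 := hb t ht
    rw [h1]
    refine (add_le_add_left (h2.trans h3.le) _).trans ?_
    change _ + f t ≤ _
    rw [le_div_iff₀ hc]
    field_simp
    linarith

lemma tail_int (ν : Measure ℝ) (hν0 : ν (Set.Iic 0) = 0)
    (hνint : ∫⁻ y in Set.Ioi (0 : ℝ), ENNReal.ofReal (min y (y ^ 2)) ∂ν ≠ ⊤)
    (η : ℝ) (hη : 0 ≤ η) (hfin : ν (Ici η) ≠ ⊤) :
    IntegrableOn (fun y => tailNu ν (η + y)) (Ioi 0) := by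
  have hanti : Antitone fun y => ν (Ici (η + y)) := fun a b hab =>
    measure_mono (Ici_subset_Ici.2 (by linarith))
  have hmeas : Measurable fun y => ν (Ici (η + y)) := hanti.measurable
  unfold tailNu
  apply integrable_toReal_of_lintegral_ne_top hmeas.aemeasurable
  have hpos : ∀ᵐ u ∂ν, 0 < u := by
    rw [ae_iff]
    convert hν0 using 2
    ext u; simp
  have key := lintegral_eq_lintegral_meas_le (ν.restrict (Ici η)) (f := fun u => max (u - η) 0)
    (by filter_upwards with u; exact le_max_right _ _) (by fun_prop)
  have h2 : ∫⁻ y in Ioi 0, ν (Ici (η + y)) = ∫⁻ t in Ioi (0:ℝ), (ν.restrict (Ici η))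
      {a : ℝ | t ≤ max (a - η) 0} := by
    apply setLIntegral_congr_fun measurableSet_Ioi
    intro y hy
    simp only
    have hy : 0 < y := hy
    rw [Measure.restrict_apply (measurableSet_le (by fun_prop) (by fun_prop))]
    congr 1
    ext u
    simp only [mem_Ici, mem_inter_iff, mem_ofPred_eq, le_max_iff]
    constructor
    · intro h; exact ⟨Or.inl (by linarith), by linarith⟩
    · rintro ⟨h | h, _⟩ <;> linarith
  rw [h2, ← key]
  have h3 : ∫⁻ u in Ici η, ENNReal.ofReal (max (u - η) 0) ∂ν ≤
      ∫⁻ u in Ici η, (ENNReal.ofReal (min u (u^2)) + 1) ∂ν := by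
    apply lintegral_mono_ae
    filter_upwards [ae_restrict_of_ae hpos] with u hu
    rw [← ENNReal.ofReal_one, ← ENNReal.ofReal_add (le_min hu.le (sq_nonneg u)) zero_le_one]
    apply ENNReal.ofReal_le_ofReal
    have : u ≤ min u (u^2) + 1 := by
      rcases min_choice u (u^2) with h | h <;> rw [h] <;> nlinarith [sq_nonneg (u-1)]
    have h0 : 0 ≤ min u (u^2) := le_min hu.le (sq_nonneg u)
    apply max_le <;> linarith
  refine ne_top_of_le_ne_top ?_ h3
  rw [lintegral_add_right _ measurable_const]
  apply ENNReal.add_ne_top.2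
  constructor
  · refine ne_top_of_le_ne_top hνint ?_
    have : ν.restrict (Ioi 0) = ν := Measure.restrict_eq_self_of_ae_mem hpos
    rw [this]
    exact setLIntegral_le_lintegral _ _
  · simpa using hfin

lemma min_int (ν : Measure ℝ) (hν0 : ν (Set.Iic 0) = 0)
    (hνint : ∫⁻ y in Set.Ioi (0 : ℝ), ENNReal.ofReal (min y (y ^ 2)) ∂ν ≠ ⊤)
    (η : ℝ) (hη : 0 ≤ η) (hfin : ν (Ici η) ≠ ⊤) (n : ℕ) (hn : 1 ≤ n)
    (L : Measure ℝ) [IsProbabilityMeasure L] (hL : L (Iic 0) = 0)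
    (htail : ∀ y : ℝ, 0 ≤ y → (L (Set.Ici y)).toReal = tailNu ν (η + y / (n : ℝ)) / tailNu ν η)
    (t : ℝ) (ht : 0 ≤ t) :
    ∫ u, min t u ∂L ≤ n * (∫ y in Ioi 0, tailNu ν (η + y)) / tailNu ν η := by
  have hpos : ∀ᵐ u ∂L, 0 < u := by
    rw [ae_iff]
    convert hL using 2
    ext u; simp
  have hn0 : (0:ℝ) < n := by exact_mod_cast hn
  have hm : Integrable (fun u => min t u) L := by
    apply Integrable.of_bound (C := t) (by fun_prop)
    filter_upwards [hpos] with u hu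
    rw [Real.norm_of_nonneg (le_min ht hu.le)]
    exact min_le_left _ _
  rw [hm.integral_eq_integral_meas_le
    (by filter_upwards [hpos] with u hu; exact le_min ht hu.le)]
  have hti := tail_int ν hν0 hνint η hη hfin
  have hinv : (0:ℝ) < (n:ℝ)⁻¹ := inv_pos.2 hn0
  have hg : IntegrableOn (fun y => tailNu ν (η + (n:ℝ)⁻¹ * y)) (Ioi 0) := by
    rw [integrableOn_Ioi_comp_mul_left_iff (fun y => tailNu ν (η + y)) 0 hinv]
    simpa using hti
  have hval := integral_comp_mul_left_Ioi (fun y => tailNu ν (η + y)) 0 hinv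
  simp only [inv_inv, mul_zero, smul_eq_mul] at hval
  rw [← hval, ← integral_div]
  apply integral_mono_of_nonneg
  · filter_upwards with y; exact measureReal_nonneg
  · exact hg.div_const _
  · filter_upwards [ae_restrict_mem measurableSet_Ioi] with y hy
    have hy : 0 < y := hy
    rw [inv_mul_eq_div, ← htail y hy.le]
    exact measureReal_mono (fun u (hu : y ≤ min t u) => (le_trans hu (min_le_right _ _) : y ≤ u))

theorem stmt8
    (b c : ℝ) (hb : 0 ≤ b) (hc : 0 < c)
    (ν : Measure ℝ) (hν0 : ν (Set.Iic 0) = 0)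
    (hνint : ∫⁻ y in Set.Ioi (0 : ℝ), ENNReal.ofReal (min y (y ^ 2)) ∂ν ≠ ⊤)
    (η θ : ℕ → ℝ) (hη : ∀ n : ℕ, 0 ≤ η n) (hθ : ∀ n : ℕ, 0 ≤ θ n ∧ θ n < 1)
    (hseq : (ν (Set.Ici (0 : ℝ)) ≠ ⊤ ∧ (∀ n : ℕ, 1 ≤ n → η n = 0) ∧
        (∀ n : ℕ, 1 ≤ n → θ n = c * tailNu ν 0 / (n : ℝ) ^ 2)) ∨
      (ν (Set.Ici (0 : ℝ)) = ⊤ ∧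
        Filter.Tendsto (fun n : ℕ => (n : ℝ) * θ n) Filter.atTop (nhds 0) ∧
        Filter.Tendsto (fun n : ℕ => (n : ℝ) ^ 2 * θ n) Filter.atTop Filter.atTop ∧
        (∀ n : ℕ, 1 ≤ n → tailNu ν (η n) = (n : ℝ) ^ 2 * θ n / c)))
    (Λ : ℕ → Measure ℝ)
    (hΛprob : ∀ n : ℕ, 1 ≤ n → IsProbabilityMeasure (Λ n))
    (hΛsupp : ∀ n : ℕ, 1 ≤ n → Λ n (Set.Iic 0) = 0)
    (hΛtail : ∀ n : ℕ, 1 ≤ n → ∀ y : ℝ, 0 ≤ y →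
      ((Λ n) (Set.Ici y)).toReal = tailNu ν (η n + y / (n : ℝ)) / tailNu ν (η n))
    :
    ∀ n : ℕ, 1 ≤ n → ∀ t : ℝ, 0 ≤ t → ∀ y : ℝ, 0 < y →
      RPi b c ν η θ Λ n t ≤ 1 / c ∧ Rtwo b c ν η θ Λ n t y ≤ 1 + min t y / c := by
  intro n hn
  have hn0 : (0:ℝ) < n := by exact_mod_cast hn
  have := hΛprob n hn
  have hL := hΛsupp n hn
  have hL0 : Λ n (Ici 0) = 1 := by
    rw [prob_compl_eq_zero_iff measurableSet_Ici |>.symm]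
    exact measure_mono_null (fun u hu => by simp at hu; exact hu.le) hL
  have hT0 : tailNu ν (η n) ≠ 0 := by
    intro h
    have := hΛtail n hn 0 le_rfl
    rw [hL0, h] at this
    simp at this
  have hfin : ν (Ici (η n)) ≠ ⊤ := by
    intro h
    apply hT0
    simp [tailNu, h]
  have hTpos : 0 < tailNu ν (η n) := lt_of_le_of_ne ENNReal.toReal_nonneg hT0.symm
  have hθeq : θ n = c * tailNu ν (η n) / (n:ℝ)^2 := by
    rcases hseq with ⟨_, h1, h2⟩ | ⟨_, _, _, h⟩
    · rw [h1 n hn, h2 n hn]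
    · rw [h n hn]; field_simp
  obtain ⟨hθ0, hθ1⟩ := hθ n
  set I := ∫ y in Set.Ioi (0 : ℝ), tailNu ν (η n + y) with hI
  have hI0 : 0 ≤ I := integral_nonneg fun y => ENNReal.toReal_nonneg
  have hg0 : 0 ≤ gam b c ν η n := by
    unfold gam; positivity
  set f : ℝ → ℝ := fun t => gam b c ν η n * PP c (θ n) (Λ n) t with hf
  have hfc : Continuous f := continuous_const.mul (PP_cont c hc _ _)
  have hf0 : ∀ t, 0 ≤ t → 0 ≤ f t := fun t _ => mul_nonneg hg0 (PP_nonneg c _ hθ0 hθ1 _ t)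
  have hfb : ∀ t, 0 ≤ t → c * f t + ∫ s in (0:ℝ)..t, f s ≤ 1 := by
    intro t ht
    have h1 := PP_int c hc (θ n) (Λ n) hL t ht
    have h2 := min_int ν hν0 hνint (η n) (hη n) hfin n hn (Λ n) hL (hΛtail n hn) t ht
    have h3 : c * f t + ∫ s in (0:ℝ)..t, f s =
        gam b c ν η n * (c + θ n * ∫ u, min t u ∂(Λ n)) := by
      rw [← h1, hf, intervalIntegral.integral_const_mul]; ring
    rw [h3]
    have h4 : θ n * ∫ u, min t u ∂(Λ n) ≤ c * (I / n) := by
      refine (mul_le_mul_of_nonneg_left h2 hθ0).trans (le_of_eq ?_)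
      rw [hθeq, ← hI]; field_simp
    have h5 : gam b c ν η n * (c + θ n * ∫ u, min t u ∂(Λ n)) ≤
        gam b c ν η n * (c + c * (I / n)) := by gcongr
    refine h5.trans ?_
    unfold gam
    rw [← hI]
    have e : (1 / c) * max 0 (1 - b / (n : ℝ) - (1 / (n : ℝ)) * I) * (c + c * (I / n)) =
      max 0 (1 - b / (n : ℝ) - I / n) * (1 + I / n) := by
      rw [one_div_mul_eq_div (n : ℝ) I]; field_simp
    rw [e]
    have hx : 0 ≤ I / n := by positivity
    have hbn : 0 ≤ b / n := by positivity
    rcases max_choice 0 (1 - b / (n : ℝ) - I / n) with h | h <;> rw [h]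
    · simp
    · nlinarith [mul_nonneg hx hbn, mul_nonneg hx hx]
  have hR : ∀ t, RPi b c ν η θ Λ n t ≤ if t < 0 then 0 else 1 / c := by
    intro t
    unfold RPi resolventSnd
    split_ifs with h
    · exact le_rfl
    · push Not at h
      have hcg : ∀ k, convIter (fun t => gam b c ν η n * piTail c (θ n) (Λ n) t) k t =
          convIter f k t := fun k => convIter_congr _ _ (fun t ht => by
            simp only [hf]; rw [piTail_eq c hc (θ n) (Λ n) hL t ht]) k t h
      simp_rw [hcg]
      exact Real.tsum_le_of_sum_range_le (fun k => convIter_nonneg f hf0 k t h)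
        (fun N => partial_le c hc f hfc hf0 hfb N t h)
  intro t ht y hy
  constructor
  · simpa [not_lt.2 ht] using hR t
  unfold Rtwo
  rw [if_neg (by push Not; exact ⟨ht, hy.le⟩)]
  have h1 : (if t < y then (1:ℝ) else 0) ≤ 1 := by split_ifs <;> norm_num
  have h2 : ∫ s in (t - y)..t, RPi b c ν η θ Λ n s ≤ min t y / c := by
    have hm : 0 ≤ min t y / c := div_nonneg (le_min ht hy.le) hc.le
    by_cases hint : IntervalIntegrable (RPi b c ν η θ Λ n) volume (t - y) t
    · have hc1 : IntervalIntegrable (fun _ : ℝ => (1 / c : ℝ)) volume (t-y) t :=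
        intervalIntegrable_const
      by_cases hty : t < y
      · have hz : t - y ≤ 0 := by linarith
        have ha : IntervalIntegrable (RPi b c ν η θ Λ n) volume (t - y) 0 :=
          hint.mono_set (by
            rw [uIcc_of_le hz, uIcc_of_le (by linarith)]; exact Icc_subset_Icc le_rfl ht)
        have hb' : IntervalIntegrable (RPi b c ν η θ Λ n) volume 0 t :=
          hint.mono_set (by
            rw [uIcc_of_le ht, uIcc_of_le (by linarith)]; exact Icc_subset_Icc hz le_rfl)
        rw [← intervalIntegral.integral_add_adjacent_intervals ha hb']
        have e1 : ∫ s in (t-y)..0, RPi b c ν η θ Λ n s ≤ ∫ s in (t-y)..0, (0:ℝ) := by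
          apply intervalIntegral.integral_mono_on_of_le_Ioo hz ha intervalIntegrable_const
          intro s hs
          simpa [hs.2] using hR s
        have e2 : ∫ s in (0:ℝ)..t, RPi b c ν η θ Λ n s ≤ ∫ s in (0:ℝ)..t, (1/c:ℝ) := by
          apply intervalIntegral.integral_mono_on ht hb' intervalIntegrable_const
          intro s hs
          simpa [not_lt.2 hs.1] using hR s
        rw [min_eq_left hty.le]
        simp only [intervalIntegral.integral_const, smul_eq_mul, mul_zero, sub_zero] at e1 e2
        have : t * (1 / c) = t / c := by ring
        linarith
      · push Not at hty
        have e2 : ∫ s in (t-y)..t, RPi b c ν η θ Λ n s ≤ ∫ s in (t-y)..t, (1/c:ℝ) := by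
          apply intervalIntegral.integral_mono_on (by linarith) hint intervalIntegrable_const
          intro s hs
          have : 0 ≤ s := by linarith [hs.1]
          simpa [not_lt.2 this] using hR s
        rw [min_eq_right hty]
        simp only [intervalIntegral.integral_const, smul_eq_mul] at e2
        have : (t - (t - y)) * (1 / c) = y / c := by ring
        linarith
    · rw [intervalIntegral.integral_undef hint]; exact hm
  linarith
end
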